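/- For every fixed integer m ≥ 1 there exists k0 = k0(m) such that for all k > k0 the following holds: if s = ch(K_{m*k}), then for every integer t ≥ 1, ch(K_{m*kt}) ≤ ((s^{1/3} + 3)·t^{1/3} - 3)^3. -/

import Mathlib

/-- A graph `G` is `s`-choosable if for every assignment of a list (finite set) of `s` colors to
each vertex there is a proper coloring choosing each vertex's color from its list. -/
def Choosable {V : Type*} (G : SimpleGraph V) (s : ℕ) : Prop :=
  ∀ L : V → Finset ℕ, (∀ v, (L v).card = s) →
    ∃ f : V → ℕ, (∀ v, f v ∈ L v) ∧ ∀ u v, G.Adj u v → f u ≠ f v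

/-- The choice number of `G`: the smallest `s` such that `G` is `s`-choosable. -/
noncomputable def choiceNumber {V : Type*} (G : SimpleGraph V) : ℕ :=
  sInf {s | Choosable G s}

/-- `K_{m*k}`: the complete `k`-partite graph with all `k` parts of size `m`. -/
abbrev Kmk (m k : ℕ) : SimpleGraph ((_ : Fin k) × Fin m) :=
  SimpleGraph.completeMultipartiteGraph fun _ : Fin k => Fin m

open Finset in
/-- Exponential moment of a random subset of `C` containing each element with probability `p`. -/
lemma moment_aux (C S : Finset ℕ) (hS : S ⊆ C) (p q w : ℝ) (hpq : p + q = 1) :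
    ∑ A ∈ C.powerset, (p ^ #A * q ^ #(C \ A)) * w ^ #(S ∩ A) = (p * w + q) ^ #S := by
  have h := Finset.prod_add (fun c => p * (if c ∈ S then w else 1)) (fun _ => q) C
  have h2 : ∏ c ∈ C, (p * (if c ∈ S then w else 1) + q) = (p * w + q) ^ #S := by
    have : ∀ c ∈ C, (p * (if c ∈ S then w else 1) + q) = if c ∈ S then p * w + q else 1 := by
      intro c _
      split_ifs
      · rfl
      · linarith
    rw [Finset.prod_congr rfl this, Finset.prod_ite_mem, Finset.inter_eq_right.2 hS,
      Finset.prod_const]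
  rw [← h2, h]
  refine Finset.sum_congr rfl fun A hA => ?_
  rw [Finset.prod_mul_distrib, Finset.prod_ite_mem, Finset.prod_const, Finset.prod_const,
    Finset.prod_const, Finset.inter_comm S A]
  ring

open Finset in
lemma moment_aux' (C S : Finset ℕ) (hS : S ⊆ C) (p q w : ℝ) (hpq : p + q = 1) :
    ∑ A ∈ C.powerset, (p ^ #A * q ^ #(C \ A)) * w ^ #(S \ A) = (q * w + p) ^ #S := by
  rw [← moment_aux C S hS q p w (by linarith)]
  refine Finset.sum_bij' (fun A _ => C \ A) (fun A _ => C \ A) ?_ ?_ ?_ ?_ ?_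
  · intro A _; simp
  · intro A _; simp
  · intro A hA; simpa using (Finset.mem_powerset.1 hA)
  · intro A hA; simpa using (Finset.mem_powerset.1 hA)
  · intro A hA
    have h1 : C \ (C \ A) = A := by simpa using (Finset.mem_powerset.1 hA)
    have h2 : S ∩ (C \ A) = S \ A := by
      ext x; simp only [mem_inter, mem_sdiff]
      constructor
      · rintro ⟨a, b, c⟩; exact ⟨a, c⟩
      · rintro ⟨a, c⟩; exact ⟨a, hS a, c⟩
    rw [h1, h2]; ring

open Finset in
lemma exists_split {ι κ : Type*} [Fintype ι] [Fintype κ] (L : ι → Finset ℕ) (M : κ → Finset ℕ)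
    (n c d : ℕ) (hL : ∀ i, #(L i) = n) (hM : ∀ i, #(M i) = n) (p q l r : ℝ)
    (hp : 0 ≤ p) (hq : 0 ≤ q) (hpq : p + q = 1) (hl : 0 ≤ l) (hr : 0 ≤ r)
    (hlt : Fintype.card ι * (Real.exp (l * c) * (p * Real.exp (-l) + q) ^ n)
      + Fintype.card κ * (Real.exp (r * d) * (q * Real.exp (-r) + p) ^ n) < 1) :
    ∃ A : Finset ℕ, (∀ i, c ≤ #(L i ∩ A)) ∧ ∀ j, d ≤ #(M j \ A) := by
  classical
  by_contra hcon
  push Not at hcon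
  set C : Finset ℕ := (univ.biUnion L) ∪ (univ.biUnion M) with hC
  have hLC : ∀ i, L i ⊆ C := fun i =>
    (Finset.subset_biUnion_of_mem L (mem_univ i)).trans subset_union_left
  have hMC : ∀ i, M i ⊆ C := fun i =>
    (Finset.subset_biUnion_of_mem M (mem_univ i)).trans subset_union_right
  have hone : ∑ A ∈ C.powerset, (p ^ #A * q ^ #(C \ A)) = 1 := by
    have := moment_aux C ∅ (by simp) p q 1 hpq
    simpa using this
  have hgood : ∀ (x : ℝ) (a b : ℕ), 0 ≤ x → b < a → 1 ≤ Real.exp (x * a) * Real.exp (-x) ^ b := by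
    intro x a b hx hab
    rw [← Real.exp_nat_mul, ← Real.exp_add]
    apply Real.one_le_exp
    have : (b : ℝ) ≤ a := by exact_mod_cast hab.le
    nlinarith
  have key : ∀ A ∈ C.powerset, (p ^ #A * q ^ #(C \ A)) ≤
      ∑ i, Real.exp (l * c) * ((p ^ #A * q ^ #(C \ A)) * Real.exp (-l) ^ #(L i ∩ A)) +
      ∑ j, Real.exp (r * d) * ((p ^ #A * q ^ #(C \ A)) * Real.exp (-r) ^ #(M j \ A)) := by
    intro A _
    have hw : 0 ≤ p ^ #A * q ^ #(C \ A) := by positivity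
    have n1 : 0 ≤ ∑ i, Real.exp (l * c) *
        ((p ^ #A * q ^ #(C \ A)) * Real.exp (-l) ^ #(L i ∩ A)) :=
      Finset.sum_nonneg fun i _ => by positivity
    have n2 : 0 ≤ ∑ j, Real.exp (r * d) *
        ((p ^ #A * q ^ #(C \ A)) * Real.exp (-r) ^ #(M j \ A)) :=
      Finset.sum_nonneg fun i _ => by positivity
    by_cases h : ∀ i, c ≤ #(L i ∩ A)
    · obtain ⟨j, hj⟩ := hcon A h
      have h1 := hgood r d _ hr hj
      have h2 := Finset.single_le_sum (f := fun j => Real.exp (r * d) *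
        ((p ^ #A * q ^ #(C \ A)) * Real.exp (-r) ^ #(M j \ A)))
        (fun i _ => by positivity) (mem_univ j)
      nlinarith
    · push Not at h
      obtain ⟨j, hj⟩ := h
      have h1 := hgood l c _ hl hj
      have h2 := Finset.single_le_sum (f := fun j => Real.exp (l * c) *
        ((p ^ #A * q ^ #(C \ A)) * Real.exp (-l) ^ #(L j ∩ A)))
        (fun i _ => by positivity) (mem_univ j)
      nlinarith
  have := Finset.sum_le_sum key
  rw [hone, Finset.sum_add_distrib, Finset.sum_comm, Finset.sum_comm (s := C.powerset)] at this
  simp only [← Finset.mul_sum] at this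
  simp only [moment_aux C _ (hLC _) p q _ hpq, moment_aux' C _ (hMC _) p q _ hpq, hL, hM,
    Finset.sum_const, Finset.card_univ, nsmul_eq_mul] at this
  linarith

lemma Choosable.of_le {V : Type*} {G : SimpleGraph V} {c : ℕ} (h : Choosable G c)
    (L : V → Finset ℕ) (hL : ∀ v, c ≤ (L v).card) :
    ∃ f : V → ℕ, (∀ v, f v ∈ L v) ∧ ∀ u v, G.Adj u v → f u ≠ f v := by
  choose M hM hMc using fun v => Finset.exists_subset_card_eq (hL v)
  obtain ⟨f, hf, hg⟩ := h M hMc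
  exact ⟨f, fun v => hM v (hf v), hg⟩

lemma choosable_choiceNumber {V : Type*} [Fintype V] (G : SimpleGraph V) :
    Choosable G (choiceNumber G) := by
  refine Nat.sInf_mem (s := {s | Choosable G s}) ⟨Fintype.card V, ?_⟩
  intro L hL
  classical
  obtain ⟨f, hf, hg⟩ := (Finset.all_card_le_biUnion_card_iff_exists_injective L).1 (by
    intro s
    rcases s.eq_empty_or_nonempty with rfl | ⟨v, hv⟩
    · simp
    · calc s.card ≤ Fintype.card V := Finset.card_le_univ s
        _ = (L v).card := (hL v).symm
        _ ≤ _ := Finset.card_le_card (Finset.subset_biUnion_of_mem L hv))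
  exact ⟨f, hg, fun u v huv h => G.ne_of_adj huv (hf h)⟩

lemma le_of_choosable {m k s : ℕ} (hm : 1 ≤ m) (h : Choosable (Kmk m k) s) : k ≤ s := by
  obtain ⟨f, hf, hg⟩ := h (fun _ => Finset.range s) (by simp)
  have : Function.Injective (fun i : Fin k => (⟨f ⟨i, ⟨0, hm⟩⟩, by simpa using hf _⟩ : Fin s)) := by
    intro i j hij
    by_contra hne
    refine hg ⟨i, ⟨0, hm⟩⟩ ⟨j, ⟨0, hm⟩⟩ ?_ (by simpa using hij)
    simpa [Kmk] using hne
  simpa using Fintype.card_le_of_injective _ this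

lemma choosable_add {m K₁ K₂ c d n : ℕ} (h1 : Choosable (Kmk m K₁) c)
    (h2 : Choosable (Kmk m K₂) d) (p q l r : ℝ)
    (hp : 0 ≤ p) (hq : 0 ≤ q) (hpq : p + q = 1) (hl : 0 ≤ l) (hr : 0 ≤ r)
    (hlt : (K₁ * m : ℝ) * (Real.exp (l * c) * (p * Real.exp (-l) + q) ^ n)
      + (K₂ * m : ℝ) * (Real.exp (r * d) * (q * Real.exp (-r) + p) ^ n) < 1) :
    Choosable (Kmk m (K₁ + K₂)) n := by
  intro L hL
  obtain ⟨A, hA, hB⟩ := exists_split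
    (fun v : (_ : Fin K₁) × Fin m => L ⟨Fin.castAdd K₂ v.1, v.2⟩)
    (fun v : (_ : Fin K₂) × Fin m => L ⟨Fin.natAdd K₁ v.1, v.2⟩) n c d
    (fun _ => hL _) (fun _ => hL _) p q l r hp hq hpq hl hr (by simpa using hlt)
  obtain ⟨f, hf, hf'⟩ := h1.of_le _ hA
  obtain ⟨g, hg, hg'⟩ := h2.of_le _ hB
  refine ⟨fun v => Fin.addCases (motive := fun _ => ℕ) (fun i => f ⟨i, v.2⟩)
    (fun j => g ⟨j, v.2⟩) v.1, ?_, ?_⟩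
  · rintro ⟨i, x⟩
    induction i using Fin.addCases with
    | left i => simpa using (Finset.mem_inter.1 (hf ⟨i, x⟩)).1
    | right i => simpa using (Finset.mem_sdiff.1 (hg ⟨i, x⟩)).1
  · rintro ⟨i, x⟩ ⟨j, y⟩ hadj
    have hne : i ≠ j := by simpa [Kmk] using hadj
    induction i using Fin.addCases with
    | left i =>
      induction j using Fin.addCases with
      | left j =>
        simp only [Fin.addCases_left]
        refine hf' _ _ ?_
        have : i ≠ j := fun h => hne (by rw [h])
        simpa [Kmk] using this
      | right j =>
        simp only [Fin.addCases_left, Fin.addCases_right]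
        intro h
        have a := (Finset.mem_inter.1 (hf ⟨i, x⟩)).2
        have b := (Finset.mem_sdiff.1 (hg ⟨j, y⟩)).2
        rw [h] at a
        exact b a
    | right i =>
      induction j using Fin.addCases with
      | right j =>
        simp only [Fin.addCases_right]
        refine hg' _ _ ?_
        have : i ≠ j := fun h => hne (by rw [h])
        simpa [Kmk] using this
      | left j =>
        simp only [Fin.addCases_left, Fin.addCases_right]
        intro h
        have a := (Finset.mem_inter.1 (hf ⟨j, y⟩)).2
        have b := (Finset.mem_sdiff.1 (hg ⟨i, x⟩)).2
        rw [← h] at a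
        exact b a

lemma exp_neg_le_quad (l : ℝ) (hl : 0 ≤ l) : Real.exp (-l) ≤ 1 - l + l ^ 2 / 2 := by
  have h := Real.quadratic_le_exp_of_nonneg hl
  rw [Real.exp_neg, inv_le_comm₀ (Real.exp_pos _) (by nlinarith [sq_nonneg (l - 1)])]
  refine le_trans ?_ h
  rw [inv_le_iff_one_le_mul₀ (by nlinarith [sq_nonneg (l - 1)])]
  nlinarith [sq_nonneg (l ^ 2)]

lemma tail_bound (p q c U : ℝ) (n : ℕ) (hp : 0 ≤ p) (hq : 0 ≤ q) (hpq : p + q = 1) (hU : 4 ≤ U)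
    (hc : c ≤ (U - 3 / 8) ^ 3) (h1 : p * n ≤ U ^ 3) (h2 : U ^ 3 - 1 ≤ p * n) :
    Real.exp (1 / (2 * U) * c) * (p * Real.exp (-(1 / (2 * U))) + q) ^ n ≤ Real.exp (-(U / 8)) := by
  have hU0 : 0 < U := by linarith
  set l := 1 / (2 * U) with hl
  have hl0 : 0 ≤ l := by positivity
  have hlU : l * U = 1 / 2 := by rw [hl]; field_simp
  have e := exp_neg_le_quad l hl0
  have b1 : p * Real.exp (-l) + q ≤ Real.exp (-(p * (l - l ^ 2 / 2))) := by
    have := Real.add_one_le_exp (-(p * (l - l ^ 2 / 2)))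
    nlinarith
  have b2 : (p * Real.exp (-l) + q) ^ n ≤ Real.exp (-(p * (l - l ^ 2 / 2))) ^ n :=
    pow_le_pow_left₀ (by positivity) b1 n
  rw [← Real.exp_nat_mul] at b2
  refine (mul_le_mul_of_nonneg_left b2 (Real.exp_pos _).le).trans ?_
  rw [← Real.exp_add, Real.exp_le_exp]
  have g : c - p * n ≤ -(U ^ 2 / 2) := by nlinarith
  have g1 : l * (c - p * n) ≤ l * (-(U ^ 2 / 2)) := mul_le_mul_of_nonneg_left g hl0
  have g2 : l ^ 2 * (p * n) ≤ l ^ 2 * U ^ 3 := mul_le_mul_of_nonneg_left h1 (sq_nonneg _)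
  have g3 : l * (-(U ^ 2 / 2)) = -(U / 4) := by
    have : l * (-(U ^ 2 / 2)) = -((l * U) * U / 2) := by ring
    rw [this, hlU]; ring
  have g4 : l ^ 2 * U ^ 3 = U / 4 := by
    have : l ^ 2 * U ^ 3 = (l * U) ^ 2 * U := by ring
    rw [this, hlU]; ring
  nlinarith

/-- All numeric facts for one side of the split. -/
lemma side_facts (s t τ k : ℕ) (c n : ℕ) (U₀ : ℝ) (ht : 1 ≤ t) (hτ : 1 ≤ τ)
    (h3 : t ≤ 3 * τ) (h3' : 3 * τ ≤ 2 * t) (hks : k ≤ s) (hk : 3 * U₀ ^ 3 ≤ k)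
    (hn : n = ⌊(((s : ℝ) ^ ((1 : ℝ) / 3) + 3) * (t : ℝ) ^ ((1 : ℝ) / 3) - 3) ^ 3⌋₊)
    (hc : (c : ℝ) ≤ (((s : ℝ) ^ ((1 : ℝ) / 3) + 3) * (τ : ℝ) ^ ((1 : ℝ) / 3) - 3) ^ 3) :
    ∃ U : ℝ, U₀ ≤ U ∧ (k * t : ℝ) ≤ 3 * U ^ 3 ∧ (c : ℝ) ≤ (U - 3 / 8) ^ 3 ∧
      (τ / t : ℝ) * n ≤ U ^ 3 ∧ U ^ 3 - 1 ≤ (τ / t : ℝ) * n := by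
  have cube : ∀ a : ℕ, ((a : ℝ) ^ ((1 : ℝ) / 3)) ^ 3 = a := by
    intro a
    rw [← Real.rpow_natCast, ← Real.rpow_mul (by positivity)]
    norm_num
  have hs0 : 0 ≤ (s : ℝ) ^ ((1 : ℝ) / 3) := by positivity
  have hx1 : 1 ≤ (t : ℝ) ^ ((1 : ℝ) / 3) :=
    Real.one_le_rpow (by exact_mod_cast ht) (by norm_num)
  have hy1 : 1 ≤ (τ : ℝ) ^ ((1 : ℝ) / 3) :=
    Real.one_le_rpow (by exact_mod_cast hτ) (by norm_num)
  have hs3 := cube s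
  have hx3 := cube t
  have hy3 := cube τ
  set b := (s : ℝ) ^ ((1 : ℝ) / 3)
  set x := (t : ℝ) ^ ((1 : ℝ) / 3)
  set y := (τ : ℝ) ^ ((1 : ℝ) / 3)
  have htr : (1 : ℝ) ≤ t := by exact_mod_cast ht
  have hx0 : 0 < x := by linarith
  have hτ3 : (t : ℝ) ≤ 3 * τ := by exact_mod_cast h3
  have hτ3' : 3 * (τ : ℝ) ≤ 2 * t := by exact_mod_cast h3'
  have hksr : (k : ℝ) ≤ s := by exact_mod_cast hks
  have hyx : y / x ≤ 7 / 8 := by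
    rw [div_le_iff₀ hx0]
    refine le_of_pow_le_pow_left₀ (n := 3) (by norm_num) (by positivity) ?_
    rw [hy3, mul_pow, hx3]
    linarith
  have hU : y / x * ((b + 3) * x - 3) = (b + 3) * y - 3 * (y / x) := by
    field_simp
  have hUb : b * y ≤ y / x * ((b + 3) * x - 3) := by rw [hU]; nlinarith
  have hU3 : (y / x * ((b + 3) * x - 3)) ^ 3 = (τ / t : ℝ) * ((b + 3) * x - 3) ^ 3 := by
    rw [mul_pow, div_pow, hx3, hy3]
  have hN : (k * t : ℝ) ≤ 3 * (y / x * ((b + 3) * x - 3)) ^ 3 := by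
    have h : (b * y) ^ 3 ≤ (y / x * ((b + 3) * x - 3)) ^ 3 :=
      pow_le_pow_left₀ (by positivity) hUb 3
    rw [mul_pow, hs3, hy3] at h
    have : (k * t : ℝ) ≤ s * (3 * τ) := by gcongr
    linarith
  have hUpos : 0 ≤ y / x * ((b + 3) * x - 3) := le_trans (by positivity) hUb
  have hF0 : 0 ≤ ((b + 3) * x - 3) ^ 3 := by
    have : 0 ≤ (b + 3) * x - 3 := by nlinarith
    positivity
  have hr0 : (0 : ℝ) ≤ τ / t := by positivity
  have hr1 : (τ / t : ℝ) ≤ 1 := by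
    rw [div_le_one (by linarith)]; linarith
  refine ⟨y / x * ((b + 3) * x - 3), ?_, hN, ?_, ?_, ?_⟩
  · refine le_of_pow_le_pow_left₀ (n := 3) (by norm_num) hUpos ?_
    have : (k : ℝ) ≤ k * t := le_mul_of_one_le_right (by positivity) htr
    linarith
  · refine hc.trans ?_
    refine pow_le_pow_left₀ ?_ ?_ 3
    · nlinarith
    · rw [hU]; linarith
  · rw [hU3, hn]
    exact mul_le_mul_of_nonneg_left (Nat.floor_le hF0) hr0
  · rw [hU3, hn]
    have := (Nat.lt_floor_add_one (((b + 3) * x - 3) ^ 3)).le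
    nlinarith

lemma exists_U0 (m : ℕ) : ∃ U₀ : ℝ, 4 ≤ U₀ ∧ ∀ U : ℝ, U₀ ≤ U →
    (m : ℝ) * (3 * U ^ 3) * Real.exp (-(U / 8)) < 1 := by
  refine ⟨4 + 3 * m * 24 * 8 ^ 4, le_add_of_nonneg_right (by positivity), fun U hU => ?_⟩
  have hm : (0 : ℝ) ≤ m := by positivity
  have hU0 : 0 < U := by nlinarith
  have h := Real.pow_div_factorial_le_exp (U / 8) (by positivity) 4
  rw [Real.exp_neg, ← div_eq_mul_inv, div_lt_one (Real.exp_pos _)]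
  refine lt_of_lt_of_le ?_ h
  have : (U / 8) ^ 4 / (Nat.factorial 4 : ℝ) = U ^ 3 * (U / (24 * 8 ^ 4)) := by
    norm_num [Nat.factorial]; ring
  rw [this]
  have h3 : (m : ℝ) * 3 < U / (24 * 8 ^ 4) := by
    rw [lt_div_iff₀ (by norm_num)]; linarith
  have := mul_lt_mul_of_pos_left h3 (pow_pos hU0 3)
  linarith

/-- **Near sub-additivity of the choice number of `K_{m*k}`.** For every fixed `m ≥ 1` there is
`k0 = k0(m)` such that for all `k > k0`, writing `s = ch(K_{m*k})`, for every `t ≥ 1` one has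
`ch(K_{m*kt}) ≤ ((s^(1/3) + 3)·t^(1/3) - 3)^3`. -/
theorem choiceNumber_Kmk_near_subadditive (m : ℕ) (hm : 1 ≤ m) :
    ∃ k0 : ℕ, ∀ k : ℕ, k0 < k → ∀ t : ℕ, 1 ≤ t →
      (choiceNumber (Kmk m (k * t)) : ℝ) ≤
        (((choiceNumber (Kmk m k) : ℝ) ^ ((1 : ℝ) / 3) + 3) * (t : ℝ) ^ ((1 : ℝ) / 3) - 3) ^ 3 := by
  obtain ⟨U₀, hU4, hU₀⟩ := exists_U0 m
  refine ⟨⌈3 * U₀ ^ 3⌉₊, fun k hk t => ?_⟩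
  have hkr : 3 * U₀ ^ 3 ≤ k := (Nat.le_ceil _).trans (by exact_mod_cast hk.le)
  have hks : k ≤ choiceNumber (Kmk m k) := le_of_choosable hm (choosable_choiceNumber _)
  induction t using Nat.strong_induction_on with
  | _ t ih =>
  intro ht
  rcases Nat.lt_or_ge 1 t with ht2 | ht1
  swap
  · obtain rfl : t = 1 := by omega
    rw [mul_one]
    simp only [Nat.cast_one, Real.one_rpow, mul_one, add_sub_cancel_right]
    rw [← Real.rpow_natCast, ← Real.rpow_mul (by positivity)]
    norm_num
  · obtain ⟨a, b, hab, ha1, hb1, ha3, ha3', hb3, hb3'⟩ : ∃ a b : ℕ, a + b = t ∧ 1 ≤ a ∧ 1 ≤ b ∧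
        t ≤ 3 * a ∧ 3 * a ≤ 2 * t ∧ t ≤ 3 * b ∧ 3 * b ≤ 2 * t :=
      ⟨t / 2, t - t / 2, by omega, by omega, by omega, by omega, by omega, by omega, by omega⟩
    have iha := ih a (by omega) ha1
    have ihb := ih b (by omega) hb1
    set s := choiceNumber (Kmk m k) with hs
    obtain ⟨n, hn⟩ : ∃ n, n = ⌊(((s : ℝ) ^ ((1 : ℝ) / 3) + 3) *
      (t : ℝ) ^ ((1 : ℝ) / 3) - 3) ^ 3⌋₊ := ⟨_, rfl⟩
    obtain ⟨U, hU, hUN, hUc, hUn, hUn'⟩ := side_facts s t a k _ n U₀ ht ha1 ha3 ha3'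
      hks hkr hn iha
    obtain ⟨W, hW, hWN, hWc, hWn, hWn'⟩ := side_facts s t b k _ n U₀ ht hb1 hb3 hb3'
      hks hkr hn ihb
    have htr : (0 : ℝ) < t := by exact_mod_cast ht
    have habr : (a : ℝ) + b = t := by exact_mod_cast hab
    have hpq : (a / t : ℝ) + b / t = 1 := by rw [← add_div, habr, div_self htr.ne']
    have hp : (0 : ℝ) ≤ a / t := by positivity
    have hq : (0 : ℝ) ≤ b / t := by positivity
    have hU' : 4 ≤ U := hU4.trans hU
    have hW' : 4 ≤ W := hU4.trans hW
    have tU := tail_bound _ _ _ U n hp hq hpq hU' hUc hUn hUn'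
    have tW := tail_bound _ _ _ W n hq hp (by linarith) hW' hWc hWn hWn'
    have fin : ∀ (τ : ℕ) (V E : ℝ), 1 ≤ τ → U₀ ≤ V → (k * t : ℝ) ≤ 3 * V ^ 3 →
        E ≤ Real.exp (-(V / 8)) → ((k * τ : ℕ) * m : ℝ) * E < τ / t := by
      intro τ V E hτ hV hN hE
      have h1 := hU₀ V hV
      have hτr : (0 : ℝ) < τ := by exact_mod_cast hτ
      have h2 : (m : ℝ) * (k * t) * E < 1 := by
        refine lt_of_le_of_lt ?_ h1
        refine (mul_le_mul_of_nonneg_left hE (by positivity)).trans ?_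
        gcongr
      rw [lt_div_iff₀ htr]
      push_cast
      nlinarith
    have hch : Choosable (Kmk m (k * t)) n := by
      rw [← hab, mul_add]
      refine choosable_add (choosable_choiceNumber _) (choosable_choiceNumber _) (a / t) (b / t)
        (1 / (2 * U)) (1 / (2 * W)) hp hq hpq (by positivity) (by positivity) ?_
      have f1 := fin a U _ ha1 hU hUN tU
      have f2 := fin b W _ hb1 hW hWN tW
      linarith
    have hle : choiceNumber (Kmk m (k * t)) ≤ n := Nat.sInf_le hch
    refine (Nat.cast_le.2 hle).trans ?_
    rw [hn]
    apply Nat.floor_le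
    have h1 : 1 ≤ (t : ℝ) ^ ((1 : ℝ) / 3) :=
      Real.one_le_rpow (by exact_mod_cast ht) (by norm_num)
    have h0 : 0 ≤ (s : ℝ) ^ ((1 : ℝ) / 3) := by positivity
    have : 0 ≤ ((s : ℝ) ^ ((1 : ℝ) / 3) + 3) * (t : ℝ) ^ ((1 : ℝ) / 3) - 3 := by nlinarith
    positivity
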